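/- Let A ≥ 3 be an integer and let f_A(y) = (1−y)³·g_A(y) for y ∈ (0,1). Then f_A(y) = F_A(y)/Q_A(y), where Q_A(y) = 1 + y + ... + y^{|R_A|−1} and F_A(y) = Σ_{k=0}^{|R_A|} β_k·y^k is the reciprocal polynomial with coefficients β_0 = β_{|R_A|} = Σ_i s_i² and β_k = 2·Σ_{i=1}^{|R_A|} s_i·s_{i+k} for 0 < k < |R_A|, where s_1, ..., s_{|R_A|} are the cyclic consecutive distances between elements of R_A (indices taken modulo |R_A|). -/

import Mathlib

open Finset

/-- The set of quadratic residues modulo `M`, as a finset of `ZMod M`. -/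
def QR (M : ℕ) : Finset (ZMod M) := (Finset.range M).image (fun a : ℕ => ((a : ZMod M)) ^ 2)

/-- The cyclic gap from `u` to the next element of `U`: the least `k ≥ 1` with `u + k ∈ U`. -/
noncomputable def cycGap (M : ℕ) (U : Finset (ZMod M)) (u : ZMod M) : ℕ :=
  sInf {k : ℕ | 0 < k ∧ u + (k : ZMod M) ∈ U}

/-- The stochasticity parameter `S(U)`: the sum of the squares of the consecutive
(cyclic) distances between elements of `U`. -/
noncomputable def stoch (M : ℕ) (U : Finset (ZMod M)) : ℕ :=
  ∑ u ∈ U, (cycGap M U u) ^ 2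

/-- The increasing list `0 = r_1 < r_2 < ... < r_{|R_A|}` of quadratic residues mod `A`
(with representatives in `{0, ..., A-1}`). -/
def resList (A : ℕ) : List ℕ := ((QR A).image ZMod.val).sort (· ≤ ·)

/-- The cyclic consecutive distances `s_1, ..., s_{|R_A|}` between quadratic residues mod `A`,
indexed from `0`, with indices taken modulo `|R_A|`. -/
def gapSeq (A : ℕ) (i : ℕ) : ℕ :=
  let l := resList A
  let n := l.length
  (l.getD ((i + 1) % n) 0 + A - l.getD (i % n) 0) % A

/-- The coefficients `β_k` of the polynomial `F_A`:
`β_0 = β_{|R_A|} = Σ_i s_i²` and `β_k = 2 Σ_i s_i s_{i+k}` for `0 < k < |R_A|`. -/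
def betaCoef (A k : ℕ) : ℕ :=
  if k = 0 ∨ k = (QR A).card then ∑ i ∈ Finset.range (QR A).card, (gapSeq A i) ^ 2
  else 2 * ∑ i ∈ Finset.range (QR A).card, gapSeq A i * gapSeq A (i + k)

/-- `F_A(y) = Σ_{k=0}^{|R_A|} β_k y^k`. -/
noncomputable def FA (A : ℕ) (y : ℝ) : ℝ :=
  ∑ k ∈ Finset.range ((QR A).card + 1), (betaCoef A k : ℝ) * y ^ k

/-- `Q_A(y) = 1 + y + ... + y^(|R_A| - 1)`. -/
noncomputable def QA (A : ℕ) (y : ℝ) : ℝ :=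
  ∑ k ∈ Finset.range (QR A).card, y ^ k

/-- `f_A(y) = F_A(y) / Q_A(y)`. -/
noncomputable def fA (A : ℕ) (y : ℝ) : ℝ := FA A y / QA A y

/-- `r(i,j) = #({i+1, ..., i+j-1} (mod A) ∩ R_A)`, with the convention `r(i,1) = 0`. -/
def rij (A : ℕ) (i : ZMod A) (j : ℕ) : ℕ :=
  ((Finset.Ico 1 j).filter (fun ν : ℕ => i + (ν : ZMod A) ∈ QR A)).card

/-- `g_A(y) = Σ_(j=1)^A Σ_(i ∈ R_A ∩ (R_A - j)) y^(r(i,j)) Σ_(k ≥ 0) y^(|R_A| k) (Ak + j)²`. -/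
noncomputable def gA (A : ℕ) (y : ℝ) : ℝ :=
  ∑ j ∈ Finset.Icc 1 A, ∑ i ∈ (QR A).filter (fun i => i + (j : ZMod A) ∈ QR A),
    y ^ (rij A i j) * ∑' k : ℕ, y ^ ((QR A).card * k) * ((A : ℝ) * k + j) ^ 2

/-- The increasing enumeration of the natural numbers that are quadratic residues mod `A`. -/
noncomputable def resEnum (A : ℕ) : ℕ → ℕ := Nat.nth (fun x : ℕ => (x : ZMod A) ∈ QR A)

section Enumeration

variable {A : ℕ}

theorem one_mem_QR (hA : 2 ≤ A) : (1 : ZMod A) ∈ QR A :=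
  Finset.mem_image.2 ⟨1, Finset.mem_range.2 (by omega), by simp⟩

theorem resEnum_count {x : ℕ} (hx : (x : ZMod A) ∈ QR A) :
    resEnum A (Nat.count (fun x : ℕ => (x : ZMod A) ∈ QR A) x) = x :=
  Nat.nth_count (p := fun x : ℕ => (x : ZMod A) ∈ QR A) hx

variable [NeZero A]

theorem zero_mem_QR : (0 : ZMod A) ∈ QR A :=
  Finset.mem_image.2 ⟨0, Finset.mem_range.2 (NeZero.pos A), by simp⟩

theorem infinite_residues : (Set.ofPred fun x : ℕ => (x : ZMod A) ∈ QR A).Infinite := by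
  refine Set.infinite_of_forall_exists_gt fun N => ⟨A * (N + 1), ?_, ?_⟩
  · change ((A * (N + 1) : ℕ) : ZMod A) ∈ QR A
    simpa using zero_mem_QR
  · have := NeZero.pos A
    nlinarith

theorem resEnum_strictMono : StrictMono (resEnum A) := Nat.nth_strictMono infinite_residues

theorem resEnum_mem (i : ℕ) : ((resEnum A i : ℕ) : ZMod A) ∈ QR A :=
  Nat.nth_mem_of_infinite infinite_residues i

theorem count_resEnum (i : ℕ) :
    Nat.count (fun x : ℕ => (x : ZMod A) ∈ QR A) (resEnum A i) = i :=
  Nat.count_nth_of_infinite infinite_residues i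

theorem image_val_QR :
    (QR A).image ZMod.val = (Finset.range A).filter (fun x : ℕ => (x : ZMod A) ∈ QR A) := by
  ext x
  simp only [Finset.mem_image, Finset.mem_filter, Finset.mem_range]
  constructor
  · rintro ⟨u, hu, rfl⟩
    exact ⟨ZMod.val_lt u, by simpa using hu⟩
  · rintro ⟨hx, h⟩
    exact ⟨x, h, ZMod.val_cast_of_lt hx⟩

theorem count_modulus : Nat.count (fun x : ℕ => (x : ZMod A) ∈ QR A) A = (QR A).card := by
  rw [Nat.count_eq_card_filter_range, ← image_val_QR,
    Finset.card_image_of_injective _ (ZMod.val_injective A)]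

theorem resEnum_add_card (i : ℕ) : resEnum A (i + (QR A).card) = resEnum A i + A := by
  have h : ((A + resEnum A i : ℕ) : ZMod A) ∈ QR A := by simpa using resEnum_mem i
  have hc := resEnum_count h
  rw [Nat.count_add, count_modulus] at hc
  simp only [Nat.cast_add, CharP.cast_eq_zero, zero_add] at hc
  rw [count_resEnum, add_comm] at hc
  rw [hc, add_comm]

theorem resEnum_zero : resEnum A 0 = 0 :=
  Nat.nth_zero_of_zero (p := fun x : ℕ => (x : ZMod A) ∈ QR A) (by simpa using zero_mem_QR)

theorem resEnum_card : resEnum A (QR A).card = A := by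
  simpa [resEnum_zero] using resEnum_add_card (A := A) 0

theorem resEnum_lt {i : ℕ} (hi : i < (QR A).card) : resEnum A i < A := by
  simpa [resEnum_card] using resEnum_strictMono (A := A) hi

theorem resEnum_sub_injective (a : ℕ) :
    Function.Injective fun m => resEnum A (a + m + 1) - resEnum A a := by
  intro k l hkl
  have h1 : resEnum A a < resEnum A (a + k + 1) := resEnum_strictMono (by omega)
  have h2 : resEnum A a < resEnum A (a + l + 1) := resEnum_strictMono (by omega)
  have h3 : a + k + 1 = a + l + 1 := (resEnum_strictMono (A := A)).injective (by simp only at hkl; omega)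
  omega

theorem injOn_resEnum_cast :
    Set.InjOn (fun a => ((resEnum A a : ℕ) : ZMod A)) (Finset.range (QR A).card) := by
  intro i hi j hj h
  have hi' := resEnum_lt (Finset.mem_range.1 hi)
  have hj' := resEnum_lt (Finset.mem_range.1 hj)
  have := congrArg ZMod.val h
  simp only [ZMod.val_cast_of_lt hi', ZMod.val_cast_of_lt hj'] at this
  exact resEnum_strictMono.injective this

theorem filter_Icc_eq_image (a : ℕ) :
    (Finset.Icc 1 A).filter (fun j : ℕ => ((resEnum A a : ℕ) : ZMod A) + (j : ZMod A) ∈ QR A) =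
      (Finset.range (QR A).card).image (fun m => resEnum A (a + m + 1) - resEnum A a) := by
  ext j
  simp only [Finset.mem_filter, Finset.mem_Icc, Finset.mem_image, Finset.mem_range]
  constructor
  · rintro ⟨⟨h1, h2⟩, h⟩
    rw [← Nat.cast_add] at h
    have hc := resEnum_count h
    set c := Nat.count (fun x : ℕ => (x : ZMod A) ∈ QR A) (resEnum A a + j)
    have hac : a < c := (resEnum_strictMono (A := A)).lt_iff_lt.1 (by omega)
    have hca : c ≤ a + (QR A).card :=
      (resEnum_strictMono (A := A)).le_iff_le.1 (by rw [resEnum_add_card]; omega)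
    refine ⟨c - a - 1, by omega, ?_⟩
    rw [show a + (c - a - 1) + 1 = c by omega, hc]
    omega
  · rintro ⟨m, hm, rfl⟩
    have h1 : resEnum A a < resEnum A (a + m + 1) := resEnum_strictMono (by omega)
    have h2 : resEnum A (a + m + 1) ≤ resEnum A (a + (QR A).card) :=
      resEnum_strictMono.monotone (by omega)
    rw [resEnum_add_card] at h2
    refine ⟨⟨by omega, by omega⟩, ?_⟩
    rw [← Nat.cast_add, Nat.add_sub_cancel' h1.le]
    exact resEnum_mem _

theorem rij_resEnum (a m : ℕ) :
    rij A ((resEnum A a : ℕ) : ZMod A) (resEnum A (a + m + 1) - resEnum A a) = m := by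
  have h1 : resEnum A a < resEnum A (a + m + 1) := resEnum_strictMono (by omega)
  have hset : (Finset.Ico 1 (resEnum A (a + m + 1) - resEnum A a)).filter
      (fun ν : ℕ => ((resEnum A a : ℕ) : ZMod A) + (ν : ZMod A) ∈ QR A) =
      (Finset.range m).image (fun k => resEnum A (a + k + 1) - resEnum A a) := by
    ext j
    simp only [Finset.mem_filter, Finset.mem_Ico, Finset.mem_image, Finset.mem_range]
    constructor
    · rintro ⟨⟨h1, h2⟩, h⟩
      rw [← Nat.cast_add] at h
      have hc := resEnum_count h
      set c := Nat.count (fun x : ℕ => (x : ZMod A) ∈ QR A) (resEnum A a + j)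
      have hac : a < c := (resEnum_strictMono (A := A)).lt_iff_lt.1 (by omega)
      have hca : c < a + m + 1 := (resEnum_strictMono (A := A)).lt_iff_lt.1 (by omega)
      refine ⟨c - a - 1, by omega, ?_⟩
      rw [show a + (c - a - 1) + 1 = c by omega, hc]
      omega
    · rintro ⟨k, hk, rfl⟩
      have h2 : resEnum A a < resEnum A (a + k + 1) := resEnum_strictMono (by omega)
      have h3 : resEnum A (a + k + 1) < resEnum A (a + m + 1) := resEnum_strictMono (by omega)
      refine ⟨⟨by omega, by omega⟩, ?_⟩
      rw [← Nat.cast_add, Nat.add_sub_cancel' h2.le]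
      exact resEnum_mem _
  rw [rij, hset, Finset.card_image_of_injective, Finset.card_range]
  exact resEnum_sub_injective a

theorem QR_eq_image :
    QR A = (Finset.range (QR A).card).image (fun a => ((resEnum A a : ℕ) : ZMod A)) := by
  symm
  refine Finset.eq_of_subset_of_card_le ?_ ?_
  · intro u hu
    obtain ⟨a, -, rfl⟩ := Finset.mem_image.1 hu
    exact resEnum_mem a
  · rw [Finset.card_image_of_injOn injOn_resEnum_cast, Finset.card_range]

theorem sum_QR (F : ZMod A → ℝ) :
    ∑ i ∈ QR A, F i = ∑ a ∈ Finset.range (QR A).card, F ((resEnum A a : ℕ) : ZMod A) := by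
  conv_lhs => rw [QR_eq_image]
  exact Finset.sum_image injOn_resEnum_cast

theorem resList_eq : resList A = (List.range (QR A).card).map (resEnum A) := by
  have hset : (QR A).image ZMod.val = ((List.range (QR A).card).map (resEnum A)).toFinset := by
    conv_lhs => rw [QR_eq_image, Finset.image_image]
    ext x
    simp only [Finset.mem_image, Finset.mem_range, Function.comp, List.mem_toFinset, List.mem_map,
      List.mem_range]
    refine exists_congr fun a => and_congr_right fun ha => ?_
    rw [ZMod.val_cast_of_lt (resEnum_lt ha)]
  rw [resList, hset]
  refine (List.toFinset_sort _ (List.nodup_range.map resEnum_strictMono.injective)).2 ?_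
  rw [List.pairwise_map]
  exact List.pairwise_lt_range.imp fun h => (resEnum_strictMono h).le

theorem one_lt_card_QR (hA : 2 ≤ A) : 1 < (QR A).card := by
  have : Fact (1 < A) := ⟨hA⟩
  exact Finset.one_lt_card.2 ⟨0, zero_mem_QR, 1, one_mem_QR hA, zero_ne_one⟩

theorem gapSeq_eq (hA : 2 ≤ A) (i : ℕ) : gapSeq A i = resEnum A (i + 1) - resEnum A i := by
  have hn := one_lt_card_QR hA
  have hper : Function.Periodic (fun i => resEnum A (i + 1) - resEnum A i) (QR A).card := by
    intro i
    simp only [show i + (QR A).card + 1 = i + 1 + (QR A).card by ring, resEnum_add_card]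
    omega
  have hget : ∀ k < (QR A).card, (resList A).getD k 0 = resEnum A k := by
    intro k hk
    rw [resList_eq, List.getD_eq_getElem _ _ (by simpa using hk)]
    simp
  have hlen : (resList A).length = (QR A).card := by simp [resList_eq]
  rw [← hper.map_mod_nat i]
  simp only [gapSeq, hlen]
  rw [← Nat.mod_add_mod]
  have ha : i % (QR A).card < (QR A).card := Nat.mod_lt _ (by omega)
  generalize i % (QR A).card = a at ha
  rw [hget a ha, hget _ (Nat.mod_lt _ (by omega))]
  have h1 : resEnum A a < resEnum A (a + 1) := resEnum_strictMono (by omega)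
  have h2 := resEnum_lt ha
  rcases (show a + 1 ≤ (QR A).card from ha).lt_or_eq with h | h
  · have h3 := resEnum_lt h
    rw [Nat.mod_eq_of_lt h, show resEnum A (a + 1) + A - resEnum A a =
      resEnum A (a + 1) - resEnum A a + A by omega, Nat.add_mod_right, Nat.mod_eq_of_lt (by omega)]
  · have h0 : resEnum A 0 < resEnum A a := resEnum_strictMono (by omega)
    rw [h, Nat.mod_self, resEnum_card, resEnum_zero, zero_add, Nat.mod_eq_of_lt (by omega)]

end Enumeration

section Series

variable {n : ℕ} {E : ℕ → ℝ} {B y : ℝ}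

theorem sum_range_shift_of_periodic {f : ℕ → ℝ} (hf : Function.Periodic f n) :
    ∑ a ∈ Finset.range n, f (a + 1) = ∑ a ∈ Finset.range n, f a := by
  have h := Finset.sum_range_succ' f n
  rw [Finset.sum_range_succ] at h
  have h0 : f n = f 0 := by simpa using hf 0
  linarith

theorem add_mul_period (hper : ∀ i, E (i + n) = E i + B) (i k : ℕ) :
    E (i + n * k) = E i + B * k := by
  induction k with
  | zero => simp
  | succ k ih =>
    rw [Nat.mul_succ, ← add_assoc, hper, ih]
    push_cast
    ring

theorem summable_increment_sq (hn : 0 < n) (hE : Monotone E) (hper : ∀ i, E (i + n) = E i + B)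
    (hy0 : 0 < y) (hy1 : y < 1) (a : ℕ) :
    Summable fun m : ℕ => y ^ m * (E (a + m) - E a) ^ 2 := by
  have hs := (summable_pow_mul_geometric_of_norm_lt_one 2
    (show ‖y‖ < 1 by rwa [Real.norm_of_nonneg hy0.le])).mul_left (B ^ 2)
  refine Summable.of_nonneg_of_le (fun m => by positivity) (fun m => ?_) hs
  have h1 : E a ≤ E (a + m) := hE (by omega)
  have h2 : E (a + m) ≤ E (a + n * m) := hE (by nlinarith)
  rw [add_mul_period hper] at h2
  have h3 : (E (a + m) - E a) ^ 2 ≤ (B * m) ^ 2 := by gcongr; linarith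
  calc y ^ m * (E (a + m) - E a) ^ 2 ≤ y ^ m * (B * m) ^ 2 := by gcongr
    _ = B ^ 2 * ((m : ℝ) ^ 2 * y ^ m) := by ring

theorem tsum_eq_sum_residues {f : ℕ → ℝ} (hf : Summable f) (hn : 0 < n) :
    ∑' m, f m = ∑ j ∈ Finset.range n, ∑' k : ℕ, f (j + n * k) := by
  obtain ⟨n, rfl⟩ : ∃ k, n = k + 1 := ⟨n - 1, by omega⟩
  rw [Nat.sumByResidueClasses hf (n + 1)]
  exact Fin.sum_univ_eq_sum_range (fun j => ∑' k : ℕ, f (j + (n + 1) * k)) (n + 1)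

/-- Multiplying the generating function of a sequence with `c 0 = 0` by `(1 - y) ^ 2` gives the
generating function of its second differences. -/
theorem one_sub_sq_mul_tsum {c b : ℕ → ℝ} (h0 : c 0 = 0) (h1 : c 1 = b 0)
    (hrec : ∀ m, c (m + 2) - 2 * c (m + 1) + c m = 2 * b (m + 1))
    (hc : Summable fun m => y ^ m * c m) (hc' : Summable fun m => y ^ m * c (m + 1))
    (hb : Summable fun m => y ^ m * b m) :
    (1 - y) ^ 2 * ∑' m, y ^ m * c (m + 1) = 2 * ∑' m, y ^ m * b m - b 0 := by
  have e1 := hc.tsum_eq_zero_add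
  have e2 := hc'.tsum_eq_zero_add
  have e3 := hb.tsum_eq_zero_add
  have s1 := (summable_nat_add_iff 1).2 hc
  have s2 := (summable_nat_add_iff 1).2 hc'
  have key : ∀ m, y ^ (m + 1) * c (m + 1 + 1) - 2 * y * (y ^ m * c (m + 1)) + y * (y ^ m * c m) =
      2 * (y ^ (m + 1) * b (m + 1)) := by
    intro m
    have := hrec m
    rw [show m + 1 + 1 = m + 2 by ring]
    linear_combination y ^ (m + 1) * this
  have hsum := tsum_congr (L := SummationFilter.unconditional ℕ) key
  rw [((s2.sub (hc'.mul_left (2 * y))).tsum_add (hc.mul_left y)),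
    s2.tsum_sub (hc'.mul_left (2 * y)), tsum_mul_left, tsum_mul_left, tsum_mul_left] at hsum
  have e4 : ∑' m, y ^ (m + 1) * c (m + 1) = y * ∑' m, y ^ m * c (m + 1) := by
    rw [← tsum_mul_left]
    exact tsum_congr fun m => by ring
  rw [e4] at e1
  simp only [pow_zero, one_mul, zero_add, h0, h1] at e1 e2 e3
  rw [e1] at hsum
  linear_combination hsum + e2 - 2 * e3

theorem one_sub_pow_mul_tsum_of_periodic {b : ℕ → ℝ} (hper : Function.Periodic b n)
    (hb : Summable fun m => y ^ m * b m) :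
    (1 - y ^ n) * ∑' m, y ^ m * b m = ∑ k ∈ Finset.range n, y ^ k * b k := by
  have h := hb.sum_add_tsum_nat_add n
  have h' : ∑' m, y ^ (m + n) * b (m + n) = y ^ n * ∑' m, y ^ m * b m := by
    rw [← tsum_mul_left]
    exact tsum_congr fun m => by rw [hper m]; ring
  rw [h'] at h
  linear_combination -h

theorem one_sub_sq_mul_sum_tsum_increment_sq (hn : 0 < n) (hE : Monotone E)
    (hper : ∀ i, E (i + n) = E i + B) (hy0 : 0 < y) (hy1 : y < 1) {b : ℕ → ℝ}
    (hb : ∀ m, b m = ∑ a ∈ Finset.range n, (E (a + 1) - E a) * (E (a + m + 1) - E (a + m))) :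
    (1 - y ^ n) * ((1 - y) ^ 2 *
      ∑ a ∈ Finset.range n, ∑' m : ℕ, y ^ m * (E (a + m + 1) - E a) ^ 2) =
    2 * ∑ k ∈ Finset.range n, y ^ k * b k - (1 - y ^ n) * b 0 := by
  set c : ℕ → ℝ := fun m => ∑ a ∈ Finset.range n, (E (a + m) - E a) ^ 2 with hcdef
  have hs := summable_increment_sq hn hE hper hy0 hy1
  have hs' : ∀ a, Summable fun m : ℕ => y ^ m * (E (a + m + 1) - E a) ^ 2 := by
    intro a
    refine (((summable_nat_add_iff 1).2 (hs a)).mul_left y⁻¹).congr fun m => ?_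
    rw [← add_assoc, pow_succ]
    field_simp
  have hc : Summable fun m => y ^ m * c m := by
    simp only [hcdef, Finset.mul_sum]
    exact summable_sum fun a _ => hs a
  have hc' : Summable fun m => y ^ m * c (m + 1) := by
    simp only [hcdef, Finset.mul_sum]
    exact summable_sum fun a _ => hs' a
  have hrec : ∀ m, c (m + 2) - 2 * c (m + 1) + c m = 2 * b (m + 1) := by
    intro m
    have h1 : c (m + 1) = ∑ a ∈ Finset.range n, (E (a + 1 + (m + 1)) - E (a + 1)) ^ 2 := by
      refine (sum_range_shift_of_periodic (f := fun a => (E (a + (m + 1)) - E a) ^ 2) ?_).symm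
      intro a
      simp only [show a + n + (m + 1) = a + (m + 1) + n by ring, hper]
      ring
    have h0 : c m = ∑ a ∈ Finset.range n, (E (a + 1 + m) - E (a + 1)) ^ 2 := by
      refine (sum_range_shift_of_periodic (f := fun a => (E (a + m) - E a) ^ 2) ?_).symm
      intro a
      simp only [show a + n + m = a + m + n by ring, hper]
      ring
    have h : c (m + 2) - c (m + 1) - c (m + 1) + c m = 2 * b (m + 1) := by
      conv_lhs => arg 1; arg 2; rw [h1]
      rw [h0, hb, hcdef]
      simp only [← Finset.sum_sub_distrib, ← Finset.sum_add_distrib, Finset.mul_sum]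
      refine Finset.sum_congr rfl fun a _ => ?_
      rw [show a + 1 + (m + 1) = a + m + 2 by ring, show a + 1 + m = a + m + 1 by ring,
        show a + (m + 2) = a + m + 2 by ring, show a + (m + 1) = a + m + 1 by ring,
        show a + m + 1 + 1 = a + m + 2 by ring]
      ring
    linarith
  have hbper : Function.Periodic b n := by
    intro m
    rw [hb, hb]
    refine Finset.sum_congr rfl fun a _ => ?_
    rw [show a + (m + n) + 1 = a + m + 1 + n by ring, show a + (m + n) = a + m + n by ring,
      hper, hper]
    ring
  have hbs : Summable fun m => y ^ m * b m := by
    have hc2 : Summable fun m => y ^ m * c (m + 2) := by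
      refine (((summable_nat_add_iff 1).2 hc').mul_left y⁻¹).congr fun m => ?_
      rw [pow_succ]
      field_simp
    refine (summable_nat_add_iff 1).1
      ((((hc2.sub (hc'.mul_left 2)).add hc).mul_left (y / 2)).congr fun m => ?_)
    have := hrec m
    rw [pow_succ]
    linear_combination y / 2 * y ^ m * this
  have hG : ∑ a ∈ Finset.range n, ∑' m : ℕ, y ^ m * (E (a + m + 1) - E a) ^ 2 =
      ∑' m, y ^ m * c (m + 1) := by
    rw [← Summable.tsum_finsetSum fun a _ => hs' a]
    simp only [hcdef, Finset.mul_sum, add_assoc]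
  rw [hG, one_sub_sq_mul_tsum (by simp [hcdef]) (by simp [hcdef, hb, sq]) hrec hc hc' hbs]
  linear_combination 2 * one_sub_pow_mul_tsum_of_periodic hbper hbs

end Series

theorem gA_eq_sum_tsum {A : ℕ} [NeZero A] {y : ℝ} (hy0 : 0 < y) (hy1 : y < 1) :
    gA A y = ∑ a ∈ Finset.range (QR A).card,
      ∑' m : ℕ, y ^ m * ((resEnum A (a + m + 1) : ℝ) - resEnum A a) ^ 2 := by
  have hn : 0 < (QR A).card := Finset.card_pos.2 ⟨0, zero_mem_QR⟩
  have hper : ∀ i, (resEnum A (i + (QR A).card) : ℝ) = resEnum A i + A := fun i => by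
    rw [resEnum_add_card, Nat.cast_add]
  have hmono : Monotone fun i => (resEnum A i : ℝ) := fun i j h =>
    Nat.cast_le.2 (resEnum_strictMono.monotone h)
  have hswap : gA A y = ∑ i ∈ QR A,
      ∑ j ∈ (Finset.Icc 1 A).filter (fun j : ℕ => i + (j : ZMod A) ∈ QR A),
        y ^ (rij A i j) * ∑' k : ℕ, y ^ ((QR A).card * k) * ((A : ℝ) * k + j) ^ 2 := by
    simp only [gA, Finset.sum_filter]
    exact Finset.sum_comm
  rw [hswap, sum_QR]
  refine Finset.sum_congr rfl fun a _ => ?_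
  have hs : Summable fun m : ℕ => y ^ m * ((resEnum A (a + m + 1) : ℝ) - resEnum A a) ^ 2 := by
    refine (((summable_nat_add_iff 1).2
      (summable_increment_sq hn hmono hper hy0 hy1 a)).mul_left y⁻¹).congr fun m => ?_
    rw [← add_assoc, pow_succ]
    field_simp
  rw [filter_Icc_eq_image, Finset.sum_image (resEnum_sub_injective a).injOn,
    tsum_eq_sum_residues hs hn]
  refine Finset.sum_congr rfl fun m _ => ?_
  rw [rij_resEnum, ← tsum_mul_left]
  refine tsum_congr fun k => ?_
  have hle : resEnum A a ≤ resEnum A (a + m + 1) := resEnum_strictMono.monotone (by omega)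
  rw [show a + (m + (QR A).card * k) + 1 = a + m + 1 + (QR A).card * k by ring,
    add_mul_period (E := fun i => (resEnum A i : ℝ)) hper, Nat.cast_sub hle, pow_add]
  ring

theorem FA_eq {A : ℕ} (hn : 0 < (QR A).card) {b : ℕ → ℝ}
    (hb : ∀ m, b m = ∑ a ∈ Finset.range (QR A).card, (gapSeq A a : ℝ) * gapSeq A (a + m))
    (y : ℝ) :
    FA A y = 2 * ∑ k ∈ Finset.range (QR A).card, y ^ k * b k - (1 - y ^ (QR A).card) * b 0 := by
  have hend : ∀ k, k = 0 ∨ k = (QR A).card → (betaCoef A k : ℝ) = b 0 := by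
    intro k hk
    rw [betaCoef, if_pos hk, hb]
    push_cast
    simp [sq]
  have hmid : ∀ k, ¬ (k = 0 ∨ k = (QR A).card) → (betaCoef A k : ℝ) = 2 * b k := by
    intro k hk
    rw [betaCoef, if_neg hk, hb]
    push_cast
    rfl
  obtain ⟨N, hN⟩ : ∃ N, (QR A).card = N + 1 := ⟨(QR A).card - 1, by omega⟩
  rw [FA, Finset.sum_range_succ, hend _ (Or.inr rfl), hN, Finset.sum_range_succ',
    Finset.sum_range_succ', hend 0 (Or.inl rfl)]
  have hcongr : ∑ k ∈ Finset.range N, (betaCoef A (k + 1) : ℝ) * y ^ (k + 1) =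
      2 * ∑ k ∈ Finset.range N, y ^ (k + 1) * b (k + 1) := by
    rw [Finset.mul_sum]
    refine Finset.sum_congr rfl fun k hk => ?_
    have := Finset.mem_range.1 hk
    rw [hmid (k + 1) (by omega)]
    ring
  rw [hcongr]
  ring

/-- Lemma 5.3: for `y ∈ (0,1)`, `(1 - y)³ g_A(y) = F_A(y) / Q_A(y)`. -/
theorem stmt_17 (A : ℕ) (hA : 3 ≤ A) (y : ℝ) (hy0 : 0 < y) (hy1 : y < 1) :
    (1 - y) ^ 3 * gA A y = FA A y / QA A y := by
  have : NeZero A := ⟨by omega⟩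
  have hn : 0 < (QR A).card := Finset.card_pos.2 ⟨0, zero_mem_QR⟩
  have hQ : 0 < QA A y :=
    Finset.sum_pos (fun k _ => pow_pos hy0 k) (Finset.nonempty_range_iff.2 hn.ne')
  have hgap : ∀ i, (gapSeq A i : ℝ) = (resEnum A (i + 1) : ℝ) - resEnum A i := fun i => by
    rw [gapSeq_eq (by omega), Nat.cast_sub (resEnum_strictMono.monotone (Nat.le_succ i))]
  have key := one_sub_sq_mul_sum_tsum_increment_sq (E := fun i => (resEnum A i : ℝ)) (B := A) hn
    (fun i j h => Nat.cast_le.2 (resEnum_strictMono.monotone h))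
    (fun i => by rw [resEnum_add_card, Nat.cast_add]) hy0 hy1 (fun m => rfl)
  have hF := FA_eq hn
    (b := fun m => ∑ a ∈ Finset.range (QR A).card, ((resEnum A (a + 1) : ℝ) - resEnum A a) *
      ((resEnum A (a + m + 1) : ℝ) - resEnum A (a + m)))
    (fun m => by simp only [hgap]) y
  rw [← gA_eq_sum_tsum hy0 hy1, ← hF, ← mul_neg_geom_sum] at key
  rw [eq_div_iff hQ.ne', ← key, QA]
  ring
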